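/- For any κ≥9 there exist constants c=c(κ)>0 and C=C(κ)<∞ such that for all L≥1, K≥2, k∈ℕ and x∈G: (i) the set 𝒜̃_{x,k} of all tuples (y_σ)_{σ∈T^{(k)}}∈Λ(L)^{T^{(k)}} such that y_σ∈B(τ(σ),l₀) for all σ for some k-proper embedding τ with base x satisfies |𝒜̃_{x,k}| ≤ exp(C·L_k·log(K)/(KL)); (ii) for every y∈𝒜̃_{x,k}, writing 𝒞(y)={y_σ : σ∈T^{(k)}} and Σ(𝒞̃)=∪_{z∈𝒞̃}B(z,8L), every subset 𝒞̃⊆𝒞(y) with |𝒞̃| ≥ 2^{k−1} satisfies |Σ(𝒞̃)|^{−2}·∑_{w,w'∈Σ(𝒞̃)}g(w,w') ≤ (c·F_ν(L_k,LK)·H̄_ν(L_k/(LK),K))^{−1}, where H̄_ν(x,y)=1/(1+x^{ν−1}y^ν) if ν<1, H̄_ν(x,y)=1/(1+y/log x) if ν=1, and H̄_ν(x,y)=y^{−ν} if ν>1. -/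

import Mathlib

open MeasureTheory Set Filter
open scoped ENNReal Topology Classical

noncomputable section

namespace Paper

variable {V : Type}

/-- Total weight at a vertex: `λ_x = ∑_y λ_{x,y}`. -/
def lamTot (lam : V → V → ℝ) (x : V) : ℝ := ∑' y, lam x y

/-- Closed ball for the distance `dd`. -/
def vball (dd : V → V → ℝ) (x : V) (r : ℝ) : Set V := {y | dd x y ≤ r}

/-- Trajectories that never return to `A` after time `0`, i.e. `H̃_A = ∞`. -/
def avoidSet (A : Set V) : Set (ℕ → V) := {ω | ∀ k, 1 ≤ k → ω k ∉ A}

variable [MeasurableSpace V]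

/-- Equilibrium measure `e_A(x) = λ_x P_x(H̃_A = ∞) 1{x ∈ A}`. -/
def equi (lam : V → V → ℝ) (P : V → Measure (ℕ → V)) (A : Set V) (x : V) : ℝ :=
  if x ∈ A then lamTot lam x * (P x (avoidSet A)).toReal else 0

/-- Capacity `cap(A) = ∑_{x ∈ A} e_A(x)`. -/
def capa (lam : V → V → ℝ) (P : V → Measure (ℕ → V)) (A : Set V) : ℝ :=
  ∑' x : A, equi lam P A x

/-- Green function `g(x,y) = λ_y⁻¹ E_x[∑_k 1{X_k = y}]`. -/
def green (lam : V → V → ℝ) (P : V → Measure (ℕ → V)) (x y : V) : ℝ :=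
  (lamTot lam y)⁻¹ * ∑' k : ℕ, (P x {ω | ω k = y}).toReal

/-- The standing assumptions on the weighted graph `(G,λ)` with distance `dd`,
random-walk law `P`, volume exponent `α`, Green exponent `ν` and asymptotic
Green constants `c₃ ≤ C₃`. -/
structure Standing (lam dd : V → V → ℝ) (P : V → Measure (ℕ → V))
    (α ν c₃ C₃ : ℝ) : Prop where
  countable : Countable V
  lam_symm : ∀ x y, lam x y = lam y x
  lam_nonneg : ∀ x y, 0 ≤ lam x y
  lam_diag : ∀ x, lam x x = 0
  locFin : ∀ x, {y | 0 < lam x y}.Finite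
  dd_self : ∀ x, dd x x = 0
  dd_pos : ∀ x y, x ≠ y → 0 < dd x y
  dd_symm : ∀ x y, dd x y = dd y x
  dd_triangle : ∀ x y z, dd x z ≤ dd x y + dd y z
  prob : ∀ x, IsProbabilityMeasure (P x)
  start : ∀ x, P x {ω | ω 0 = x} = 1
  step : ∀ x y, P x {ω | ω 1 = y} = ENNReal.ofReal (lam x y / lamTot lam x)
  markov : ∀ (x y : V) (k : ℕ) (S : Set (ℕ → V)), MeasurableSet S →
    P x ({ω | ω k = y} ∩ {ω | (fun n => ω (k + n)) ∈ S}) = P x {ω | ω k = y} * P y S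
  nu_pos : 0 < ν
  nu_le : ν ≤ α - 2
  vol : ∃ c₁ C₁ : ℝ, 0 < c₁ ∧ c₁ ≤ C₁ ∧ ∀ (x : V) (r : ℝ), 1 ≤ r →
    c₁ * r ^ α ≤ ∑' y : vball dd x r, lamTot lam y ∧
      ∑' y : vball dd x r, lamTot lam y ≤ C₁ * r ^ α
  greenBounds : ∃ c₂ C₂ : ℝ, 0 < c₂ ∧ c₂ ≤ C₂ ∧
    (∀ x, c₂ ≤ green lam P x x ∧ green lam P x x ≤ C₂) ∧
    ∀ x y, x ≠ y → c₂ * dd x y ^ (-ν) ≤ green lam P x y ∧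
      green lam P x y ≤ C₂ * dd x y ^ (-ν)
  c₃_pos : 0 < c₃
  c₃_le_C₃ : c₃ ≤ C₃
  greenAsymp : ∀ η' : ℝ, 0 < η' → ∃ M : ℝ, ∀ x y, M ≤ dd x y →
    (1 - η') * c₃ ≤ green lam P x y * dd x y ^ ν ∧
      green lam P x y * dd x y ^ ν ≤ (1 + η') * C₃
  p0 : ∃ c : ℝ, 0 < c ∧ ∀ x y, 0 < lam x y → c ≤ lam x y / lamTot lam x

/-- The geodesic assumption: from every point there is an infinite
nearest-neighbour path along which `dd` is comparable to the index difference. -/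
def Geodesic (lam dd : V → V → ℝ) (c₄ C₄ : ℝ) : Prop :=
  ∀ x : V, ∃ γ : ℕ → V, γ 0 = x ∧ (∀ k : ℕ, 0 < lam (γ k) (γ (k + 1))) ∧
    ∀ k p : ℕ, c₄ * |(k : ℝ) - (p : ℝ)| - C₄ ≤ dd (γ k) (γ p) ∧
      dd (γ k) (γ p) ≤ c₄ * |(k : ℝ) - (p : ℝ)| + C₄

/-- The function `F_ν(x,y)`. -/
def Fnu (ν x y : ℝ) : ℝ :=
  if ν < 1 then x ^ ν
  else if ν = 1 then x / max 1 (Real.log (x / y))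
  else x * y ^ (ν - 1)

/-- `F_ν(x) = F_ν(x,1)`. -/
def Fnu1 (ν x : ℝ) : ℝ := Fnu ν x 1

/-- The constant `π⁻¹ B((1+ν)/2,(1+ν)/2) cos(πν/2)` for `ν < 1` and `1/2` for `ν = 1`
(the Beta function expressed through `Γ`). -/
def kappaNu (ν : ℝ) : ℝ :=
  if ν < 1 then
    Real.Gamma ((1 + ν) / 2) * Real.Gamma ((1 + ν) / 2) / Real.Gamma (1 + ν)
      * Real.cos (Real.pi * ν / 2) / Real.pi
  else 1 / 2

/-- `c_β`, defined by `c_β · C₃ = kappaNu ν`. -/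
def cBeta (ν C₃ : ℝ) : ℝ := kappaNu ν / C₃

/-- `C_β`, defined by `C_β · c₃ = kappaNu ν`. -/
def CBeta (ν c₃ : ℝ) : ℝ := kappaNu ν / c₃

/-- `a` and `b` are joined by a nearest-neighbour path inside `S`. -/
def connIn (lam : V → V → ℝ) (S : Set V) (a b : V) : Prop :=
  ∃ (m : ℕ) (γ : ℕ → V), γ 0 = a ∧ γ m = b ∧ (∀ i ≤ m, γ i ∈ S) ∧
    ∀ i < m, 0 < lam (γ i) (γ (i + 1))

/-- The set `X̄_A` of points visited by a trajectory strictly before exiting `A`. -/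
def visited (A : Set V) (ω : ℕ → V) : Set V :=
  {v | ∃ k : ℕ, (∀ n ≤ k, ω n ∈ A) ∧ ω k = v}

/-- Properties of the renormalised families `Λ(L)`. -/
structure LamFamily (dd : V → V → ℝ) (α : ℝ) (Lam : ℝ → Set V) : Prop where
  cover : ∀ L : ℝ, 1 ≤ L → ∀ x : V, ∃ y ∈ Lam L, dd y x ≤ L
  card : ∃ CΛ : ℝ, 0 < CΛ ∧ ∀ L : ℝ, 1 ≤ L → ∀ (x : V) (N : ℝ), 1 ≤ N →
    (Lam L ∩ vball dd x (L * N)).Finite ∧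
      ((Lam L ∩ vball dd x (L * N)).ncard : ℝ) ≤ CΛ * N ^ α
  one : Lam 1 = Set.univ

/-- `γ 0, …, γ m` is an `L`-nearest-neighbour path in `Λ(L)`. -/
def IsLPath (lam dd : V → V → ℝ) (Lam : ℝ → Set V) (L : ℝ) (γ : ℕ → V) (m : ℕ) : Prop :=
  (∀ i ≤ m, γ i ∈ Lam L) ∧ ∀ i < m,
    (1 < L ∧ ∃ a b, dd (γ i) a ≤ L ∧ dd (γ (i + 1)) b ≤ L ∧ 0 < lam a b) ∨
    (L = 1 ∧ 0 < lam (γ i) (γ (i + 1)))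

/-- The scales `L_k`: `L₀ = κLK`, `L_{k+1} = 2(L_k + κ l_k)` with `l_k = L_k/(k+1)²`. -/
def Lsc (L K κ : ℝ) : ℕ → ℝ
  | 0 => κ * L * K
  | k + 1 => 2 * (Lsc L K κ k + κ * (Lsc L K κ k / ((k : ℝ) + 1) ^ 2))

/-- `l_k = L_k/(k+1)²`. -/
def lsc (L K κ : ℝ) (k : ℕ) : ℝ := Lsc L K κ k / ((k : ℝ) + 1) ^ 2

/-- `I_k(x) = Λ(l_k) ∩ B(x, l_{k+1} + l_k)`. -/
def Ifam (dd : V → V → ℝ) (Lam : ℝ → Set V) (L K κ : ℝ) (k : ℕ) (x : V) : Set V :=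
  Lam (lsc L K κ k) ∩ vball dd x (lsc L K κ (k + 1) + lsc L K κ k)

/-- `E_k(x) = Λ(l_k) ∩ (B(x, 2l_k + L_{k+1}) \ B(x, L_{k+1} - l_k))`. -/
def Efam (dd : V → V → ℝ) (Lam : ℝ → Set V) (L K κ : ℝ) (k : ℕ) (x : V) : Set V :=
  Lam (lsc L K κ k) ∩
    (vball dd x (2 * lsc L K κ k + Lsc L K κ (k + 1)) \
      vball dd x (Lsc L K κ (k + 1) - lsc L K κ k))

/-- A `k`-proper embedding of the binary tree `T_k` (nodes = lists of booleans of
length at most `k`) with base `x`. -/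
structure ProperEmbedding (lam dd : V → V → ℝ) (Lam : ℝ → Set V) (L K κ : ℝ)
    (k : ℕ) (x : V) (τ : List Bool → V) : Prop where
  base : τ [] = x
  child : ∀ n : ℕ, n + 1 ≤ k → ∀ σ : List Bool, σ.length = n →
    τ (σ ++ [false]) ∈ Ifam dd Lam L K κ (k - n - 1) (τ σ) ∧
    τ (σ ++ [true]) ∈ Efam dd Lam L K κ (k - n - 1) (τ σ)
  sep : ∀ n ≤ k, ∀ σ σ' : List Bool, σ.length = n → σ'.length = n → σ ≠ σ' →
    2 * Lsc L K κ (k - n) + κ * lsc L K κ (k - n) ≤ dd (τ σ) (τ σ')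
  near : ∀ n ≤ k, ∀ σ σ' : List Bool, σ.length = n → σ'.length = k - n →
    (vball dd (τ σ) (2 * Lsc L K κ (k - n)) ∩
      vball dd (τ (σ ++ σ')) (2 * Lsc L K κ 0)).Nonempty

/-- The function `H̄_ν`. -/
def HbarNu (ν x y : ℝ) : ℝ :=
  if ν < 1 then 1 / (1 + x ^ (ν - 1) * y ^ ν)
  else if ν = 1 then 1 / (1 + y / Real.log x)
  else y ^ (-ν)

/-- The family `𝒜̃_{x,k}` of tuples `(y_σ)_{σ ∈ T^{(k)}}` in `Λ(L)` lying in the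
bottom boxes of some `k`-proper embedding with base `x`. -/
def Atil (lam dd : V → V → ℝ) (Lam : ℝ → Set V) (L K κ : ℝ) (k : ℕ) (x : V) :
    Set ({σ : List Bool // σ.length = k} → V) :=
  {y | (∀ σ, y σ ∈ Lam L) ∧
    ∃ τ : List Bool → V, ProperEmbedding lam dd Lam L K κ k x τ ∧
      ∀ σ : {σ : List Bool // σ.length = k}, dd (τ σ.1) (y σ) ≤ lsc L K κ 0}

/-- A point of the state space is either null for the starting position of `P x`, or
it induces the same law as `x`. -/
lemma Standing.start_eq_zero_or_law_eq {lam dd : V → V → ℝ} {P : V → Measure (ℕ → V)}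
    {α ν c₃ C₃ : ℝ} (h : Standing lam dd P α ν c₃ C₃) (x y : V) :
    P x {ω | ω 0 = y} = 0 ∨ P x = P y := by
  have := h.prob x
  have := h.prob y
  by_cases hsep : ∃ U : Set V, MeasurableSet U ∧ x ∈ U ∧ y ∉ U
  · left
    obtain ⟨U, hU, hx, hy⟩ := hsep
    have hm : MeasurableSet {ω : ℕ → V | ω 0 ∈ U} := measurable_pi_apply 0 hU
    have h1 : P x {ω | ω 0 ∈ U} = 1 := by
      refine le_antisymm prob_le_one ?_
      rw [← h.start x]
      exact measure_mono fun ω (hω : ω 0 = x) => by simpa [hω] using hx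
    have h0 : P x {ω | ω 0 ∈ U}ᶜ = 0 := (prob_compl_eq_zero_iff hm).2 h1
    exact measure_mono_null (fun ω (hω : ω 0 = y) => by simpa [hω] using hy) h0
  · right
    push Not at hsep
    have hiff : ∀ U : Set V, MeasurableSet U → (x ∈ U ↔ y ∈ U) := fun U hU =>
      ⟨hsep U hU, fun hy => by
        by_contra hx
        exact hsep Uᶜ hU.compl hx hy⟩
    let φ : (ℕ → V) → (ℕ → V) := fun ω => if ω 0 = x then Function.update ω 0 y else ω
    have hφ : (MeasurableSpace.pi : MeasurableSpace (ℕ → V)) ≤ MeasurableSpace.invariants φ := by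
      refine iSup_le fun i => ?_
      rintro _ ⟨U, hU, rfl⟩
      rw [MeasurableSpace.measurableSet_invariants]
      refine ⟨measurable_pi_apply i hU, ?_⟩
      ext ω
      simp only [mem_preimage, φ]
      split_ifs with h0
      · by_cases hi : i = 0
        · subst hi
          simp [h0, hiff U hU]
        · simp [hi]
      · rfl
    have h1 : P x {ω | ω 0 = y} = 1 := by
      refine le_antisymm prob_le_one ?_
      rw [← measure_toMeasurable {ω : ℕ → V | ω 0 = y}, ← h.start x]
      refine measure_mono fun ω (hω : ω 0 = x) => ?_
      have := (MeasurableSpace.measurableSet_invariants.1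
        (hφ _ (measurableSet_toMeasurable (P x) {ω : ℕ → V | ω 0 = y}))).2
      rw [← this]
      refine subset_toMeasurable _ _ ?_
      simp [φ, hω]
    refine Measure.ext fun S hS => ?_
    have hm := h.markov x y 0 S hS
    simp only [zero_add, h1, one_mul] at hm
    refine le_antisymm ?_ (hm ▸ measure_mono inter_subset_right)
    have hm' := h.markov x y 0 Sᶜ hS.compl
    simp only [zero_add, h1, one_mul] at hm'
    have hc : P y Sᶜ ≤ P x Sᶜ := hm' ▸ measure_mono inter_subset_right
    rw [prob_compl_eq_one_sub hS, prob_compl_eq_one_sub hS] at hc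
    exact (ENNReal.sub_le_sub_iff_left prob_le_one ENNReal.one_ne_top).1 hc

/-- One-step upper bound in the Chapman-Kolmogorov relation. -/
lemma Standing.prob_succ_le {lam dd : V → V → ℝ} {P : V → Measure (ℕ → V)}
    {α ν c₃ C₃ : ℝ} (h : Standing lam dd P α ν c₃ C₃) (x y : V) (k : ℕ) :
    P x {ω | ω (k + 1) = y} ≤ ∑' z, P x {ω | ω 1 = z} * P z {ω | ω k = y} := by
  have := h.countable
  let S : Set (ℕ → V) := ⋂ z, toMeasurable (P z) {ω | ω k = y}
  have hS : MeasurableSet S := MeasurableSet.iInter fun z => measurableSet_toMeasurable _ _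
  have hsub : {ω : ℕ → V | ω k = y} ⊆ S := subset_iInter fun z => subset_toMeasurable _ _
  have hcov : {ω : ℕ → V | ω (k + 1) = y} ⊆
      ⋃ z, {ω | ω 1 = z} ∩ {ω | (fun n => ω (1 + n)) ∈ S} := by
    intro ω hω
    refine mem_iUnion.2 ⟨ω 1, rfl, hsub ?_⟩
    simpa [add_comm] using hω
  refine (measure_mono hcov).trans ((measure_iUnion_le _).trans (ENNReal.tsum_le_tsum fun z => ?_))
  rw [h.markov x z 1 S hS]
  refine mul_le_mul' le_rfl ?_
  exact (measure_mono (iInter_subset (fun z => toMeasurable (P z) {ω | ω k = y}) z)).trans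
    (measure_toMeasurable _).le

lemma Standing.lamTot_pos {lam dd : V → V → ℝ} {P : V → Measure (ℕ → V)}
    {α ν c₃ C₃ : ℝ} (h : Standing lam dd P α ν c₃ C₃) (x : V) : 0 < lamTot lam x := by
  obtain ⟨c₂, C₂, hc, -, hg, -⟩ := h.greenBounds
  refine (tsum_nonneg fun y => h.lam_nonneg x y).lt_of_ne fun h0 => ?_
  have := (hg x).1
  simp only [green, lamTot, ← h0] at this
  simp at this
  linarith

lemma Standing.summable_lam {lam dd : V → V → ℝ} {P : V → Measure (ℕ → V)}
    {α ν c₃ C₃ : ℝ} (h : Standing lam dd P α ν c₃ C₃) (x : V) : Summable (lam x) :=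
  summable_of_hasFiniteSupport <| (h.locFin x).subset fun y hy =>
    (h.lam_nonneg x y).lt_of_ne (Ne.symm hy)

lemma Standing.tsum_step {lam dd : V → V → ℝ} {P : V → Measure (ℕ → V)}
    {α ν c₃ C₃ : ℝ} (h : Standing lam dd P α ν c₃ C₃) (x : V) :
    ∑' z, P x {ω | ω 1 = z} = 1 := by
  simp only [h.step]
  rw [← ENNReal.ofReal_tsum_of_nonneg
    (fun z => div_nonneg (h.lam_nonneg x z) (h.lamTot_pos x).le)
    ((h.summable_lam x).div_const _), tsum_div_const]
  have : ∑' y, lam x y = lamTot lam x := rfl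
  rw [this, div_self (h.lamTot_pos x).ne', ENNReal.ofReal_one]

/-- The truncated Green function is maximal on the diagonal. -/
lemma Standing.sum_prob_le {lam dd : V → V → ℝ} {P : V → Measure (ℕ → V)}
    {α ν c₃ C₃ : ℝ} (h : Standing lam dd P α ν c₃ C₃) (y : V) (n : ℕ) (x : V) :
    ∑ k ∈ Finset.range n, P x {ω | ω k = y} ≤ ∑ k ∈ Finset.range n, P y {ω | ω k = y} := by
  induction n generalizing x with
  | zero => simp
  | succ n ih =>
    rcases h.start_eq_zero_or_law_eq x y with h0 | h0
    · rw [Finset.sum_range_succ', h0, add_zero]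
      calc ∑ k ∈ Finset.range n, P x {ω | ω (k + 1) = y}
          ≤ ∑ k ∈ Finset.range n, ∑' z, P x {ω | ω 1 = z} * P z {ω | ω k = y} :=
            Finset.sum_le_sum fun k _ => h.prob_succ_le x y k
        _ = ∑' z, P x {ω | ω 1 = z} * ∑ k ∈ Finset.range n, P z {ω | ω k = y} := by
            rw [← Summable.tsum_finsetSum (fun _ _ => ENNReal.summable)]
            simp only [Finset.mul_sum]
        _ ≤ ∑' z, P x {ω | ω 1 = z} * ∑ k ∈ Finset.range n, P y {ω | ω k = y} :=
            ENNReal.tsum_le_tsum fun z => mul_le_mul' le_rfl (ih z)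
        _ = ∑ k ∈ Finset.range n, P y {ω | ω k = y} := by
            rw [ENNReal.tsum_mul_right, h.tsum_step, one_mul]
        _ ≤ _ := Finset.sum_le_sum_of_subset (Finset.range_subset_range.2 n.le_succ)
    · rw [h0]

lemma Standing.summable_prob {lam dd : V → V → ℝ} {P : V → Measure (ℕ → V)}
    {α ν c₃ C₃ : ℝ} (h : Standing lam dd P α ν c₃ C₃) (x : V) :
    Summable fun k : ℕ => (P x {ω | ω k = x}).toReal := by
  obtain ⟨c₂, C₂, hc, -, hg, -⟩ := h.greenBounds
  by_contra hs
  have := (hg x).1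
  simp only [green, tsum_eq_zero_of_not_summable hs, mul_zero] at this
  linarith

lemma Standing.green_le_diag {lam dd : V → V → ℝ} {P : V → Measure (ℕ → V)}
    {α ν c₃ C₃ : ℝ} (h : Standing lam dd P α ν c₃ C₃) (x y : V) :
    green lam P x y ≤ green lam P y y := by
  have := h.prob
  refine mul_le_mul_of_nonneg_left ?_ (inv_nonneg.2 (h.lamTot_pos y).le)
  refine Real.tsum_le_of_sum_range_le (fun _ => ENNReal.toReal_nonneg) fun n => ?_
  refine le_trans ?_ ((h.summable_prob y).sum_le_tsum (Finset.range n)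
    fun _ _ => ENNReal.toReal_nonneg)
  rw [← ENNReal.toReal_sum fun _ _ => measure_ne_top _ _,
    ← ENNReal.toReal_sum fun _ _ => measure_ne_top _ _]
  exact ENNReal.toReal_mono (ENNReal.sum_ne_top.2 fun _ _ => measure_ne_top _ _)
    (h.sum_prob_le y n x)

lemma Standing.green_le {lam dd : V → V → ℝ} {P : V → Measure (ℕ → V)}
    {α ν c₃ C₃ : ℝ} (h : Standing lam dd P α ν c₃ C₃) :
    ∃ C : ℝ, 0 < C ∧ (∀ x y, green lam P x y ≤ C) ∧
      ∀ x y, x ≠ y → green lam P x y ≤ C * dd x y ^ (-ν) := by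
  obtain ⟨c₂, C₂, hc, hcC, hg, hg'⟩ := h.greenBounds
  exact ⟨C₂, hc.trans_le hcC, fun x y => (h.green_le_diag x y).trans (hg y).2,
    fun x y hxy => (hg' x y hxy).2⟩

lemma Standing.one_le_mul_lamTot {lam dd : V → V → ℝ} {P : V → Measure (ℕ → V)}
    {α ν c₃ C₃ : ℝ} (h : Standing lam dd P α ν c₃ C₃) (x : V) :
    1 ≤ lamTot lam x * green lam P x x := by
  rw [green, ← mul_assoc, mul_inv_cancel₀ (h.lamTot_pos x).ne', one_mul]
  have := (h.summable_prob x).le_tsum 0 fun _ _ => ENNReal.toReal_nonneg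
  rwa [h.start x, ENNReal.toReal_one] at this

/-- Volume regularity for the counting measure. -/
lemma Standing.ball_card {lam dd : V → V → ℝ} {P : V → Measure (ℕ → V)}
    {α ν c₃ C₃ : ℝ} (h : Standing lam dd P α ν c₃ C₃) :
    ∃ c C : ℝ, 0 < c ∧ 0 < C ∧ ∀ (x : V) (r : ℝ), 1 ≤ r → (vball dd x r).Finite ∧
      c * r ^ α ≤ (vball dd x r).ncard ∧ ((vball dd x r).ncard : ℝ) ≤ C * r ^ α := by
  obtain ⟨c₁, C₁, hc₁, hcC₁, hvol⟩ := h.vol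
  obtain ⟨C₂, hC₂, hg, -⟩ := h.green_le
  have hC₁ := hc₁.trans_le hcC₁
  have hlow : ∀ x, C₂⁻¹ ≤ lamTot lam x := fun x => by
    rw [inv_le_iff_one_le_mul₀ hC₂]
    exact (h.one_le_mul_lamTot x).trans
      (mul_le_mul_of_nonneg_left (hg x x) (h.lamTot_pos x).le)
  have hsum : ∀ (x : V) (r : ℝ), 1 ≤ r →
      Summable fun y : vball dd x r => lamTot lam y := fun x r hr => by
    by_contra hs
    have h1 := (hvol x r hr).1
    rw [tsum_eq_zero_of_not_summable hs] at h1
    have : 0 < c₁ * r ^ α := by positivity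
    linarith
  have hup : ∀ x, lamTot lam x ≤ C₁ := fun x => by
    have h1 := (hvol x 1 le_rfl).2
    rw [Real.one_rpow, mul_one] at h1
    exact ((hsum x 1 le_rfl).le_tsum ⟨x, by simp [vball, h.dd_self]⟩
      fun y _ => (h.lamTot_pos y).le).trans h1
  refine ⟨c₁ / C₁, C₂ * C₁, by positivity, by positivity, fun x r hr => ?_⟩
  have hfin : (vball dd x r).Finite := by
    by_contra hinf
    have := Set.infinite_coe_iff.2 hinf
    have h0 := (hsum x r hr).tendsto_cofinite_zero
    have h1 := ge_of_tendsto' h0 fun y => hlow y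
    have : 0 < C₂⁻¹ := by positivity
    linarith
  have hft := hfin.fintype
  have hv := hvol x r hr
  rw [tsum_fintype] at hv
  have hcard : ((vball dd x r).ncard : ℝ) = ∑ y : vball dd x r, (1 : ℝ) := by
    rw [Finset.sum_const, nsmul_one, Finset.card_univ, ← Nat.card_eq_fintype_card,
      Nat.card_coe_set_eq]
  refine ⟨hfin, ?_, ?_⟩
  · rw [div_mul_eq_mul_div, div_le_iff₀ hC₁, hcard, Finset.sum_mul]
    refine hv.1.trans (Finset.sum_le_sum fun y _ => ?_)
    simpa using hup y
  · rw [mul_assoc, hcard, ← inv_mul_le_iff₀ hC₂, Finset.mul_sum]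
    refine (Finset.sum_le_sum fun y _ => ?_).trans hv.2
    simpa using hlow y

section Scales

variable {L K κ : ℝ}

lemma Lsc_pos (hL : 1 ≤ L) (hK : 2 ≤ K) (hκ : 9 ≤ κ) (k : ℕ) : 0 < Lsc L K κ k := by
  induction k with
  | zero => simp only [Lsc]; positivity
  | succ k ih => simp only [Lsc]; positivity

lemma lsc_pos (hL : 1 ≤ L) (hK : 2 ≤ K) (hκ : 9 ≤ κ) (k : ℕ) : 0 < lsc L K κ k := by
  have := Lsc_pos hL hK hκ k
  unfold lsc
  positivity

lemma two_mul_Lsc_le (hL : 1 ≤ L) (hK : 2 ≤ K) (hκ : 9 ≤ κ) (k : ℕ) :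
    2 * Lsc L K κ k ≤ Lsc L K κ (k + 1) := by
  have := lsc_pos hL hK hκ k
  simp only [Lsc]
  unfold lsc at this
  nlinarith

lemma le_Lsc (hL : 1 ≤ L) (hK : 2 ≤ K) (hκ : 9 ≤ κ) (k : ℕ) :
    κ * (L * K) * 2 ^ k ≤ Lsc L K κ k := by
  induction k with
  | zero => simp [Lsc, mul_assoc]
  | succ k ih =>
    refine le_trans ?_ (two_mul_Lsc_le hL hK hκ k)
    rw [pow_succ]
    linarith

lemma Lsc_le (hL : 1 ≤ L) (hK : 2 ≤ K) (hκ : 9 ≤ κ) (k : ℕ) :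
    Lsc L K κ k ≤ κ * Real.exp (2 * κ) * (L * K) * 2 ^ k := by
  have key : Lsc L K κ k ≤ κ * (L * K) * 2 ^ k * Real.exp (κ * (2 - 2 / ((k : ℝ) + 1))) := by
    induction k with
    | zero => simp [Lsc, mul_assoc]
    | succ k ih =>
      have h1 : Lsc L K κ (k + 1) = 2 * Lsc L K κ k * (1 + κ / ((k : ℝ) + 1) ^ 2) := by
        simp only [Lsc]; ring
      have h2 : 1 + κ / ((k : ℝ) + 1) ^ 2 ≤ Real.exp (κ / ((k : ℝ) + 1) ^ 2) := by
        rw [add_comm]; exact Real.add_one_le_exp _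
      have h3 : κ / ((k : ℝ) + 1) ^ 2 + κ * (2 - 2 / ((k : ℝ) + 1)) ≤
          κ * (2 - 2 / (((k + 1 : ℕ) : ℝ) + 1)) := by
        have : 1 / ((k : ℝ) + 1) ^ 2 ≤ 2 / ((k : ℝ) + 1) - 2 / ((k : ℝ) + 1 + 1) := by
          rw [div_sub_div _ _ (by positivity) (by positivity),
            div_le_div_iff₀ (by positivity) (by positivity)]
          have : (0 : ℝ) ≤ k := k.cast_nonneg
          nlinarith
        push_cast
        have := mul_le_mul_of_nonneg_left this (by linarith : 0 ≤ κ)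
        rw [mul_one_div] at this
        linarith
      have h4 := Real.exp_le_exp.2 h3
      rw [Real.exp_add] at h4
      have := Lsc_pos hL hK hκ k
      calc Lsc L K κ (k + 1) = 2 * Lsc L K κ k * (1 + κ / ((k : ℝ) + 1) ^ 2) := h1
        _ ≤ 2 * (κ * (L * K) * 2 ^ k * Real.exp (κ * (2 - 2 / ((k : ℝ) + 1)))) *
            Real.exp (κ / ((k : ℝ) + 1) ^ 2) := by gcongr
        _ = κ * (L * K) * 2 ^ (k + 1) * (Real.exp (κ / ((k : ℝ) + 1) ^ 2) *
            Real.exp (κ * (2 - 2 / ((k : ℝ) + 1)))) := by ring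
        _ ≤ _ := by gcongr
  refine key.trans ?_
  have : Real.exp (κ * (2 - 2 / ((k : ℝ) + 1))) ≤ Real.exp (2 * κ) := by
    refine Real.exp_le_exp.2 ?_
    have : 0 ≤ 2 / ((k : ℝ) + 1) := by positivity
    nlinarith
  calc _ ≤ κ * (L * K) * 2 ^ k * Real.exp (2 * κ) := by gcongr
    _ = _ := by ring

lemma Lsc_mono (hL : 1 ≤ L) (hK : 2 ≤ K) (hκ : 9 ≤ κ) : Monotone (Lsc L K κ) :=
  monotone_nat_of_le_succ fun k => by
    have := two_mul_Lsc_le hL hK hκ k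
    have := Lsc_pos hL hK hκ k
    linarith

lemma one_le_lsc (hL : 1 ≤ L) (hK : 2 ≤ K) (hκ : 9 ≤ κ) (k : ℕ) : 1 ≤ lsc L K κ k := by
  have h2 : ((k : ℝ) + 1) ^ 2 ≤ 18 * 2 ^ k := by
    have h : ∀ n : ℕ, (n + 1) ^ 2 ≤ 18 * 2 ^ n := by
      intro n
      induction n with
      | zero => norm_num
      | succ n ih =>
        rcases le_or_gt n 1 with h | h
        · interval_cases n <;> norm_num
        · rw [pow_succ 2 n]
          nlinarith
    exact_mod_cast h k
  rw [lsc, le_div_iff₀ (by positivity), one_mul]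
  refine h2.trans (le_trans ?_ (le_Lsc hL hK hκ k))
  have : 1 * 2 ≤ L * K := mul_le_mul hL hK (by norm_num) (by linarith)
  have : 9 * (1 * 2) ≤ κ * (L * K) := mul_le_mul hκ this (by norm_num) (by linarith)
  gcongr
  linarith

lemma Lsc_succ_eq (k : ℕ) :
    Lsc L K κ (k + 1) = lsc L K κ k * (2 * (((k : ℝ) + 1) ^ 2 + κ)) := by
  simp only [Lsc, lsc]
  field_simp

lemma lsc_succ_le (hL : 1 ≤ L) (hK : 2 ≤ K) (hκ : 9 ≤ κ) (k : ℕ) :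
    lsc L K κ (k + 1) ≤ lsc L K κ k * (2 * (1 + κ)) := by
  have h0 := lsc_pos hL hK hκ k
  have hk : (0 : ℝ) ≤ k := k.cast_nonneg
  have h1 : lsc L K κ (k + 1) = Lsc L K κ (k + 1) / (((k + 1 : ℕ) : ℝ) + 1) ^ 2 := rfl
  rw [h1, Lsc_succ_eq, div_le_iff₀ (by positivity), mul_assoc]
  refine mul_le_mul_of_nonneg_left ?_ h0.le
  push_cast
  nlinarith [mul_nonneg hk hk, mul_nonneg hk (mul_nonneg hk (by linarith : 0 ≤ κ)), mul_nonneg hk (by linarith : 0 ≤ κ)]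

end Scales

/-- Layered upper bound for a sum in terms of the cardinalities of sublevel sets of `d`. -/
lemma sum_le_of_card_sublevel_le {ι : Type*} (d g : ι → ℝ) {M : ℝ} {r a N : ℕ → ℝ}
    (hM0 : 0 ≤ M) (ha0 : ∀ j, 0 ≤ a j) (n : ℕ) (S : Finset ι) (hM : ∀ s ∈ S, g s ≤ M)
    (ha : ∀ j < n, ∀ s ∈ S, r j < d s → g s ≤ a j)
    (hN : ∀ j < n, ((S.filter fun s => d s ≤ r j).card : ℝ) ≤ N j)
    (hS : (S.card : ℝ) ≤ N n) :
    ∑ s ∈ S, g s ≤ M * N 0 + ∑ j ∈ Finset.range n, a j * N (j + 1) := by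
  induction n generalizing S with
  | zero =>
    have := Finset.sum_le_card_nsmul S g M hM
    rw [nsmul_eq_mul] at this
    simp only [Finset.range_zero, Finset.sum_empty, add_zero]
    nlinarith
  | succ n ih =>
    rw [← Finset.sum_filter_add_sum_filter_not S (fun s => d s ≤ r n), Finset.sum_range_succ,
      ← add_assoc]
    refine add_le_add (ih _ (fun s hs => hM s (Finset.mem_filter.1 hs).1)
      (fun j hj s hs => ha j (by omega) s (Finset.mem_filter.1 hs).1) (fun j hj => ?_)
      (hN n n.lt_succ_self)) ?_
    · refine le_trans ?_ (hN j (by omega))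
      exact_mod_cast Finset.card_le_card
        (Finset.filter_subset_filter _ (Finset.filter_subset _ _))
    · have h1 := Finset.sum_le_card_nsmul (S.filter fun s => ¬ d s ≤ r n) g (a n) fun s hs =>
        ha n n.lt_succ_self s (Finset.mem_filter.1 hs).1 (not_le.1 (Finset.mem_filter.1 hs).2)
      rw [nsmul_eq_mul] at h1
      have h2 : ((S.filter fun s => ¬ d s ≤ r n).card : ℝ) ≤ N (n + 1) :=
        le_trans (by exact_mod_cast Finset.card_filter_le _ _) hS
      nlinarith [ha0 n]

lemma geom_sum_le_of_one_lt {q : ℝ} (hq : 1 < q) (n : ℕ) :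
    ∑ j ∈ Finset.range n, q ^ j ≤ q ^ n / (q - 1) := by
  rw [geom_sum_eq hq.ne']
  gcongr
  linarith

/-- The energy bound obtained by summing over scales, compared with `F_ν` and `H̄_ν`. -/
lemma exists_energy_le {κ ν : ℝ} (hκ : 9 ≤ κ) (hν : 0 < ν) :
    ∃ A : ℝ, 0 < A ∧ ∀ L K : ℝ, 1 ≤ L → 2 ≤ K → ∀ k : ℕ,
      L ^ (-ν) * ((2 : ℝ) ^ k)⁻¹ *
          (1 + K ^ (-ν) * ∑ j ∈ Finset.range (k + 1), ((2 : ℝ) ^ (1 - ν)) ^ j) ≤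
        A * (Fnu ν (Lsc L K κ k) (L * K) * HbarNu ν (Lsc L K κ k / (L * K)) K)⁻¹ := by
  set B := κ * Real.exp (2 * κ) with hB
  have hB0 : 0 < B := by positivity
  -- It suffices to bound the sum, in terms of `X = L_k / (L K)`.
  suffices h : ∃ D : ℝ, 0 < D ∧ ∀ L K : ℝ, 1 ≤ L → 2 ≤ K → ∀ (k : ℕ) (X : ℝ), (2 : ℝ) ^ k ≤ X →
      9 * (2 : ℝ) ^ k ≤ X → L ^ (-ν) * X⁻¹ *
        (1 + K ^ (-ν) * ∑ j ∈ Finset.range (k + 1), ((2 : ℝ) ^ (1 - ν)) ^ j) ≤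
        D * (Fnu ν (X * (L * K)) (L * K) * HbarNu ν X K)⁻¹ by
    obtain ⟨D, hD, h⟩ := h
    refine ⟨B * D, by positivity, fun L K hL hK k => ?_⟩
    have hLK : 0 < L * K := by positivity
    have hlow : 9 * (2 : ℝ) ^ k ≤ Lsc L K κ k / (L * K) := by
      rw [le_div_iff₀ hLK]
      refine le_trans ?_ (le_Lsc hL hK hκ k)
      calc 9 * (2 : ℝ) ^ k * (L * K) = 9 * (L * K) * 2 ^ k := by ring
        _ ≤ _ := by gcongr
    have hup : Lsc L K κ k / (L * K) ≤ B * 2 ^ k := by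
      rw [div_le_iff₀ hLK]
      refine (Lsc_le hL hK hκ k).trans (le_of_eq ?_)
      ring
    have h2k : (0 : ℝ) < 2 ^ k := by positivity
    have hX := h L K hL hK k (Lsc L K κ k / (L * K)) (by linarith) hlow
    rw [div_mul_cancel₀ _ hLK.ne'] at hX
    have hX0 : 0 < Lsc L K κ k / (L * K) := by linarith
    have hinv : ((2 : ℝ) ^ k)⁻¹ ≤ B * (Lsc L K κ k / (L * K))⁻¹ := by
      rw [← div_eq_mul_inv, le_div_iff₀ hX0, inv_mul_le_iff₀ h2k]
      linarith
    have hS : 0 ≤ 1 + K ^ (-ν) * ∑ j ∈ Finset.range (k + 1), ((2 : ℝ) ^ (1 - ν)) ^ j := by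
      positivity
    calc _ ≤ L ^ (-ν) * (B * (Lsc L K κ k / (L * K))⁻¹) *
          (1 + K ^ (-ν) * ∑ j ∈ Finset.range (k + 1), ((2 : ℝ) ^ (1 - ν)) ^ j) := by gcongr
      _ = B * (L ^ (-ν) * (Lsc L K κ k / (L * K))⁻¹ *
          (1 + K ^ (-ν) * ∑ j ∈ Finset.range (k + 1), ((2 : ℝ) ^ (1 - ν)) ^ j)) := by ring
      _ ≤ B * (D * (Fnu ν (Lsc L K κ k) (L * K) * HbarNu ν (Lsc L K κ k / (L * K)) K)⁻¹) := by
          gcongr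
      _ = _ := by ring
  rcases lt_trichotomy ν 1 with h1 | h1 | h1
  · set q := (2 : ℝ) ^ (1 - ν) with hq
    have hq1 : 1 < q := Real.one_lt_rpow (by norm_num) (by linarith)
    have hq0 : 0 < q / (q - 1) := div_pos (by linarith) (by linarith)
    refine ⟨1 + q / (q - 1), by positivity, fun L K hL hK k X hX _ => ?_⟩
    have h2k : (0 : ℝ) < 2 ^ k := by positivity
    have hX0 : 0 < X := by linarith
    have hL0 : 0 < L := by linarith
    have hK0 : 0 < K := by linarith
    have hsum : ∑ j ∈ Finset.range (k + 1), q ^ j ≤ q / (q - 1) * X ^ (1 - ν) := by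
      refine (geom_sum_le_of_one_lt hq1 (k + 1)).trans ?_
      have : q ^ k ≤ X ^ (1 - ν) := by
        rw [hq, ← Real.rpow_mul_natCast (by norm_num), mul_comm, Real.rpow_natCast_mul (by norm_num)]
        exact Real.rpow_le_rpow h2k.le hX (by linarith)
      rw [pow_succ, mul_div_assoc, mul_comm]
      gcongr
    have hF : (Fnu ν (X * (L * K)) (L * K) * HbarNu ν X K)⁻¹ =
        L ^ (-ν) * X⁻¹ * (1 + K ^ (-ν) * X ^ (1 - ν)) := by
      simp only [Fnu, HbarNu, if_pos h1]
      rw [Real.mul_rpow hX0.le (by positivity), Real.mul_rpow hL0.le hK0.le,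
        Real.rpow_sub hX0, Real.rpow_sub hX0, Real.rpow_neg hL0.le, Real.rpow_neg hK0.le,
        Real.rpow_one]
      have := Real.rpow_pos_of_pos hX0 ν
      have := Real.rpow_pos_of_pos hL0 ν
      have := Real.rpow_pos_of_pos hK0 ν
      field_simp
      ring
    rw [hF]
    have hKX : 0 ≤ K ^ (-ν) * X ^ (1 - ν) := by positivity
    have hKs := mul_le_mul_of_nonneg_left hsum (by positivity : 0 ≤ K ^ (-ν))
    calc _ ≤ L ^ (-ν) * X⁻¹ * ((1 + q / (q - 1)) * (1 + K ^ (-ν) * X ^ (1 - ν))) := by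
          gcongr
          nlinarith
      _ = _ := by ring
  · subst h1
    have hl2 := Real.log_pos (by norm_num : (1 : ℝ) < 2)
    refine ⟨1 + (Real.log 2)⁻¹, by positivity, fun L K hL hK k X hX hX9 => ?_⟩
    have h2k : (1 : ℝ) ≤ 2 ^ k := one_le_pow₀ (by norm_num)
    have hX0 : 0 < X := by linarith
    have hlog1 : 1 ≤ Real.log X := by
      rw [Real.le_log_iff_exp_le hX0]
      have := Real.exp_one_lt_d9
      linarith
    have hlogk : ((k : ℝ) + 1) ≤ (Real.log 2)⁻¹ * Real.log X := by
      rw [← div_eq_inv_mul, le_div_iff₀ hl2]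
      have : Real.log ((2 : ℝ) ^ (k + 1)) ≤ Real.log X :=
        Real.log_le_log (by positivity) (by rw [pow_succ]; linarith)
      rwa [Real.log_pow, Nat.cast_succ] at this
    have hLK : L * K ≠ 0 := by positivity
    have hF : (Fnu 1 (X * (L * K)) (L * K) * HbarNu 1 X K)⁻¹ =
        L⁻¹ * X⁻¹ * (1 + K⁻¹ * Real.log X) := by
      simp only [Fnu, HbarNu, lt_irrefl, if_false, if_true]
      rw [mul_div_cancel_right₀ _ hLK, max_eq_right hlog1]
      field_simp
      ring
    rw [hF]
    simp only [sub_self, Real.rpow_zero, one_pow, Finset.sum_const, Finset.card_range,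
      nsmul_eq_mul, mul_one, Real.rpow_neg_one, Nat.cast_succ]
    have hKs := mul_le_mul_of_nonneg_left hlogk (by positivity : 0 ≤ K⁻¹)
    have : 0 ≤ (Real.log 2)⁻¹ := by positivity
    have hKX : 0 ≤ K⁻¹ * Real.log X := by positivity
    calc _ ≤ L⁻¹ * X⁻¹ * ((1 + (Real.log 2)⁻¹) * (1 + K⁻¹ * Real.log X)) := by
          gcongr
          nlinarith
      _ = _ := by ring
  · set q := (2 : ℝ) ^ (1 - ν) with hq
    have hq1 : q < 1 := Real.rpow_lt_one_of_one_lt_of_neg (by norm_num) (by linarith)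
    have hq0 : 0 < (1 - q)⁻¹ := inv_pos.2 (by linarith)
    have hqp : 0 ≤ q := by positivity
    refine ⟨1 + (1 - q)⁻¹, by positivity, fun L K hL hK k X hX _ => ?_⟩
    have h2k : (0 : ℝ) < 2 ^ k := by positivity
    have hX0 : 0 < X := by linarith
    have hL0 : 0 < L := by linarith
    have hK0 : 0 < K := by linarith
    have hsum : ∑ j ∈ Finset.range (k + 1), q ^ j ≤ (1 - q)⁻¹ := by
      rw [← tsum_geometric_of_lt_one hqp hq1]
      exact (summable_geometric_of_lt_one hqp hq1).sum_le_tsum _ fun _ _ => by positivity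
    have hF : (Fnu ν (X * (L * K)) (L * K) * HbarNu ν X K)⁻¹ = L ^ (-ν) * X⁻¹ := by
      simp only [Fnu, HbarNu, if_neg h1.not_gt, if_neg h1.ne']
      rw [Real.mul_rpow hL0.le hK0.le, Real.rpow_sub hL0, Real.rpow_sub hK0,
        Real.rpow_neg hL0.le, Real.rpow_neg hK0.le, Real.rpow_one, Real.rpow_one]
      have := Real.rpow_pos_of_pos hL0 ν
      have := Real.rpow_pos_of_pos hK0 ν
      field_simp
    rw [hF, mul_comm (1 + (1 - q)⁻¹)]
    gcongr
    have hK1 : K ^ (-ν) ≤ 1 := Real.rpow_le_one_of_one_le_of_nonpos (by linarith) (by linarith)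
    have hs0 : 0 ≤ ∑ j ∈ Finset.range (k + 1), q ^ j := by positivity
    nlinarith

lemma finite_biUnion_and_ncard_le {ι β : Type*} {s : Set ι} {t : ι → Set β} {b : ℝ}
    (hs : s.Finite) (ht : ∀ i ∈ s, (t i).Finite ∧ ((t i).ncard : ℝ) ≤ b) :
    (⋃ i ∈ s, t i).Finite ∧ ((⋃ i ∈ s, t i).ncard : ℝ) ≤ s.ncard * b := by
  induction s, hs using Set.Finite.induction_on with
  | empty => simp
  | @insert a s ha hs ih =>
    have ih := ih fun i hi => ht i (mem_insert_of_mem _ hi)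
    have h1 := ht a (mem_insert _ _)
    rw [biUnion_insert, ncard_insert_of_notMem ha hs]
    refine ⟨h1.1.union ih.1, ?_⟩
    have : ((t a ∪ ⋃ i ∈ s, t i).ncard : ℝ) ≤ (t a).ncard + (⋃ i ∈ s, t i).ncard := by
      exact_mod_cast ncard_union_le _ _
    push_cast
    linarith [h1.2, ih.2]

section LeafFamilies

variable {X : Type}

/-- The leaf families of tree embeddings for which only the constraints relating
parents and children are kept. -/
def leafFamily (dd : X → X → ℝ) (Lam : ℝ → Set X) (L K κ : ℝ) (k : ℕ) (x : X) :
    Set ({σ : List Bool // σ.length = k} → X) :=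
  {y | ∃ τ : List Bool → X, τ [] = x ∧
    (∀ σ : List Bool, σ.length + 1 ≤ k →
      τ (σ ++ [false]) ∈ Ifam dd Lam L K κ (k - σ.length - 1) (τ σ) ∧
      τ (σ ++ [true]) ∈ Efam dd Lam L K κ (k - σ.length - 1) (τ σ)) ∧
    ∀ σ, y σ ∈ Lam L ∧ dd (τ σ.1) (y σ) ≤ lsc L K κ 0}

lemma Atil_subset_leafFamily (lam dd : X → X → ℝ) (Lam : ℝ → Set X) (L K κ : ℝ) (k : ℕ)
    (x : X) : Atil lam dd Lam L K κ k x ⊆ leafFamily dd Lam L K κ k x := by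
  rintro y ⟨hy, τ, hτ, hd⟩
  exact ⟨τ, hτ.base, fun σ hσ => hτ.child _ hσ σ rfl, fun σ => ⟨hy σ, hd σ⟩⟩

/-- The two halves of a leaf family indexed by the two subtrees below the root. -/
def splitLeaves {k : ℕ} (y : {σ : List Bool // σ.length = k + 1} → X) :
    ({σ : List Bool // σ.length = k} → X) × ({σ : List Bool // σ.length = k} → X) :=
  (fun t => y ⟨false :: t.1, by simp [t.2]⟩, fun t => y ⟨true :: t.1, by simp [t.2]⟩)

lemma splitLeaves_injective {k : ℕ} :
    Function.Injective (splitLeaves : ({σ : List Bool // σ.length = k + 1} → X) → _) := by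
  intro y y' h
  funext ⟨σ, hσ⟩
  match σ, hσ with
  | false :: t, hσ => exact congrFun (congrArg Prod.fst h) ⟨t, by simpa using hσ⟩
  | true :: t, hσ => exact congrFun (congrArg Prod.snd h) ⟨t, by simpa using hσ⟩

lemma splitLeaves_mem {dd : X → X → ℝ} {Lam : ℝ → Set X} {L K κ : ℝ} {k : ℕ} {x : X}
    {y : {σ : List Bool // σ.length = k + 1} → X}
    (hy : y ∈ leafFamily dd Lam L K κ (k + 1) x) :
    splitLeaves y ∈ ⋃ p ∈ Ifam dd Lam L K κ k x ×ˢ Efam dd Lam L K κ k x,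
      leafFamily dd Lam L K κ k p.1 ×ˢ leafFamily dd Lam L K κ k p.2 := by
  obtain ⟨τ, h0, hch, hlf⟩ := hy
  have hroot := hch [] (by simp)
  rw [h0] at hroot
  simp only [List.nil_append, List.length_nil, Nat.sub_zero, Nat.add_sub_cancel] at hroot
  have hsub : ∀ b : Bool, (fun t : {σ : List Bool // σ.length = k} =>
      y ⟨b :: t.1, by simp [t.2]⟩) ∈ leafFamily dd Lam L K κ k (τ [b]) := by
    intro b
    refine ⟨fun t => τ (b :: t), rfl, fun σ hσ => ?_, fun σ => hlf _⟩
    have := hch (b :: σ) (by simpa using hσ)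
    simp only [List.length_cons, List.cons_append] at this
    rwa [show k + 1 - (σ.length + 1) - 1 = k - σ.length - 1 by omega] at this
  exact mem_biUnion (x := (τ [false], τ [true])) ⟨hroot.1, hroot.2⟩ ⟨hsub false, hsub true⟩

lemma rpow_le_exp_mul {t α : ℝ} (ht : 0 < t) (hα : 0 ≤ α) : t ^ α ≤ Real.exp (α * t) := by
  rw [Real.rpow_def_of_pos ht, mul_comm]
  have := Real.log_le_sub_one_of_pos ht
  gcongr
  linarith

lemma LamFamily.card_le {dd : X → X → ℝ} {α : ℝ} {Lam : ℝ → Set X} {C R r N : ℝ}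
    (h : ∀ L : ℝ, 1 ≤ L → ∀ (x : X) (N : ℝ), 1 ≤ N →
      (Lam L ∩ vball dd x (L * N)).Finite ∧
        ((Lam L ∩ vball dd x (L * N)).ncard : ℝ) ≤ C * N ^ α)
    (hR : 1 ≤ R) (hN : 1 ≤ N) (hr : r ≤ R * N) (x : X) (S : Set X)
    (hS : S ⊆ Lam R ∩ vball dd x r) : S.Finite ∧ (S.ncard : ℝ) ≤ C * N ^ α := by
  have hsub : S ⊆ Lam R ∩ vball dd x (R * N) := fun y hy =>
    ⟨(hS hy).1, le_trans (hS hy).2 hr⟩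
  have := h R hR x N hN
  refine ⟨this.1.subset hsub, le_trans ?_ this.2⟩
  exact_mod_cast ncard_le_ncard hsub this.1

/-- The number of admissible pairs of children is at most exponential in the scale index. -/
lemma LamFamily.children_card_le {dd : X → X → ℝ} {α : ℝ} {Lam : ℝ → Set X}
    (h : LamFamily dd α Lam) (hα : 0 ≤ α) {κ : ℝ} (hκ : 9 ≤ κ) :
    ∃ D : ℝ, 0 < D ∧ ∀ L K : ℝ, 1 ≤ L → 2 ≤ K → ∀ (k : ℕ) (x : X),
      (Ifam dd Lam L K κ k x ×ˢ Efam dd Lam L K κ k x).Finite ∧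
      ((Ifam dd Lam L K κ k x ×ˢ Efam dd Lam L K κ k x).ncard : ℝ) ≤
        Real.exp (D * (k + 1)) := by
  obtain ⟨C, hC, hcard⟩ := h.card
  refine ⟨2 * C + α * (3 + 2 * κ) + α * (4 + 2 * κ) + 2 * α, by positivity,
    fun L K hL hK k x => ?_⟩
  have hl := one_le_lsc hL hK hκ k
  have hk : (0 : ℝ) ≤ k := k.cast_nonneg
  have hI : (Ifam dd Lam L K κ k x).Finite ∧
      ((Ifam dd Lam L K κ k x).ncard : ℝ) ≤ C * (3 + 2 * κ) ^ α := by
    refine LamFamily.card_le hcard hl (by linarith) ?_ x _ subset_rfl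
    have := lsc_succ_le hL hK hκ k
    linarith
  have hE : (Efam dd Lam L K κ k x).Finite ∧
      ((Efam dd Lam L K κ k x).ncard : ℝ) ≤
        C * ((4 + 2 * κ) * (((k : ℝ) + 1) * ((k : ℝ) + 1))) ^ α := by
    refine LamFamily.card_le (r := 2 * lsc L K κ k + Lsc L K κ (k + 1)) hcard hl ?_ ?_ x _
      fun y hy => ⟨hy.1, hy.2.1⟩
    · nlinarith [mul_nonneg hk hk]
    · rw [Lsc_succ_eq, mul_comm 2, ← mul_add]
      refine mul_le_mul_of_nonneg_left ?_ (by linarith)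
      nlinarith [mul_nonneg hk hk, mul_nonneg hk (mul_nonneg hk (by linarith : 0 ≤ κ)),
        mul_nonneg hk (by linarith : 0 ≤ κ)]
  refine ⟨hI.1.prod hE.1, ?_⟩
  rw [ncard_prod]
  push_cast
  have hC' : C ≤ Real.exp C := by linarith [Real.add_one_le_exp C]
  calc ((Ifam dd Lam L K κ k x).ncard : ℝ) * ((Efam dd Lam L K κ k x).ncard : ℝ)
      ≤ (C * (3 + 2 * κ) ^ α) * (C * ((4 + 2 * κ) * (((k : ℝ) + 1) * ((k : ℝ) + 1))) ^ α) := by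
        gcongr
        exacts [hI.2, hE.2]
    _ = (C * (3 + 2 * κ) ^ α) * (C * ((4 + 2 * κ) ^ α * (((k : ℝ) + 1) ^ α *
          ((k : ℝ) + 1) ^ α))) := by
        rw [Real.mul_rpow (by linarith) (by positivity),
          Real.mul_rpow (by positivity) (by positivity)]
    _ ≤ (Real.exp C * Real.exp (α * (3 + 2 * κ))) * (Real.exp C * (Real.exp (α * (4 + 2 * κ)) *
          (Real.exp (α * ((k : ℝ) + 1)) * Real.exp (α * ((k : ℝ) + 1))))) := by
        gcongr <;> exact rpow_le_exp_mul (by positivity) hα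
    _ = Real.exp (2 * C + α * (3 + 2 * κ) + α * (4 + 2 * κ) + 2 * α * ((k : ℝ) + 1)) := by
        simp only [← Real.exp_add]
        ring_nf
    _ ≤ _ := by
        refine Real.exp_le_exp.2 ?_
        have h1 : 0 ≤ 2 * C + α * (3 + 2 * κ) + α * (4 + 2 * κ) := by positivity
        nlinarith [mul_nonneg hk h1]

/-- Entropy bound for the leaf families. -/
lemma LamFamily.leafFamily_card_le {dd : X → X → ℝ} {α : ℝ} {Lam : ℝ → Set X}
    (h : LamFamily dd α Lam) (hα : 0 ≤ α) {κ : ℝ} (hκ : 9 ≤ κ) :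
    ∃ C : ℝ, 0 < C ∧ ∀ L K : ℝ, 1 ≤ L → 2 ≤ K → ∀ (k : ℕ) (x : X),
      (leafFamily dd Lam L K κ k x).Finite ∧
      ((leafFamily dd Lam L K κ k x).ncard : ℝ) ≤
        Real.exp (C * Lsc L K κ k * Real.log K / (K * L)) := by
  obtain ⟨D, hD, hchild⟩ := h.children_card_le hα hκ
  obtain ⟨CΛ, hC, hcard⟩ := h.card
  have hκ0 : 0 < κ := by linarith
  have hlogκ : 0 ≤ Real.log κ := Real.log_nonneg (by linarith)
  have hl2 := Real.log_pos (by norm_num : (1 : ℝ) < 2)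
  refine ⟨(CΛ + α * Real.log κ + 2 * D) / Real.log 2 + α, by positivity,
    fun L K hL hK k x => ?_⟩
  have hK0 : 0 < K := by linarith
  have hL0 : 0 < L := by linarith
  have hlogK : Real.log 2 ≤ Real.log K := Real.log_le_log (by norm_num) hK
  set A := CΛ + α * Real.log κ + 2 * D + α * Real.log K with hA
  have key : ∀ (k : ℕ) (x : X), (leafFamily dd Lam L K κ k x).Finite ∧
      ((leafFamily dd Lam L K κ k x).ncard : ℝ) ≤ Real.exp (A * 2 ^ k - D * (k + 2)) := by
    intro k
    induction k with
    | zero =>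
      intro x
      have hroot : (Lam L ∩ vball dd x (lsc L K κ 0)).Finite ∧
          ((Lam L ∩ vball dd x (lsc L K κ 0)).ncard : ℝ) ≤ CΛ * (κ * K) ^ α := by
        refine LamFamily.card_le hcard hL ?_ ?_ x _ subset_rfl
        · nlinarith
        · simp only [lsc, Lsc]
          refine le_of_eq ?_
          norm_num
          ring
      have hinj : Function.Injective
          fun y : {σ : List Bool // σ.length = 0} → X => y ⟨[], rfl⟩ := by
        intro y y' hyy
        funext ⟨σ, hσ⟩
        obtain rfl := List.length_eq_zero_iff.1 hσ
        exact hyy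
      have hmaps : ∀ y ∈ leafFamily dd Lam L K κ 0 x,
          y ⟨[], rfl⟩ ∈ Lam L ∩ vball dd x (lsc L K κ 0) := by
        rintro y ⟨τ, h0, -, hlf⟩
        have := hlf ⟨[], rfl⟩
        simp only [h0] at this
        exact this
      refine ⟨Set.Finite.of_injOn hmaps hinj.injOn hroot.1, ?_⟩
      have hle : ((leafFamily dd Lam L K κ 0 x).ncard : ℝ) ≤
          (Lam L ∩ vball dd x (lsc L K κ 0)).ncard := by
        exact_mod_cast ncard_le_ncard_of_injOn _ hmaps hinj.injOn hroot.1
      refine hle.trans (hroot.2.trans ?_)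
      have hC' : CΛ ≤ Real.exp CΛ := by linarith [Real.add_one_le_exp CΛ]
      calc CΛ * (κ * K) ^ α ≤ Real.exp CΛ * (κ * K) ^ α := by gcongr
        _ = Real.exp (A * 2 ^ 0 - D * ((0 : ℕ) + 2)) := by
          rw [Real.rpow_def_of_pos (by positivity), Real.log_mul hκ0.ne' hK0.ne',
            ← Real.exp_add, hA]
          congr 1
          push_cast
          ring
    | succ k ih =>
      intro x
      obtain ⟨hf, hc⟩ := hchild L K hL hK k x
      have hU := finite_biUnion_and_ncard_le (t := fun p : X × X =>
        leafFamily dd Lam L K κ k p.1 ×ˢ leafFamily dd Lam L K κ k p.2)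
        (b := Real.exp (A * 2 ^ k - D * (k + 2)) * Real.exp (A * 2 ^ k - D * (k + 2))) hf
        fun p _ => by
          refine ⟨(ih p.1).1.prod (ih p.2).1, ?_⟩
          rw [ncard_prod, Nat.cast_mul]
          exact mul_le_mul (ih p.1).2 (ih p.2).2 (Nat.cast_nonneg _) (Real.exp_pos _).le
      have hmaps : ∀ y ∈ leafFamily dd Lam L K κ (k + 1) x, splitLeaves y ∈ _ :=
        fun y hy => splitLeaves_mem hy
      refine ⟨Set.Finite.of_injOn hmaps splitLeaves_injective.injOn hU.1, ?_⟩
      have hle : ((leafFamily dd Lam L K κ (k + 1) x).ncard : ℝ) ≤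
          (⋃ p ∈ Ifam dd Lam L K κ k x ×ˢ Efam dd Lam L K κ k x,
            leafFamily dd Lam L K κ k p.1 ×ˢ leafFamily dd Lam L K κ k p.2).ncard := by
        exact_mod_cast ncard_le_ncard_of_injOn _ hmaps splitLeaves_injective.injOn hU.1
      refine hle.trans (hU.2.trans ?_)
      refine (mul_le_mul_of_nonneg_right hc (by positivity)).trans (le_of_eq ?_)
      simp only [← Real.exp_add]
      congr 1
      push_cast
      ring
  refine ⟨(key k x).1, (key k x).2.trans (Real.exp_le_exp.2 ?_)⟩
  have hB : A ≤ ((CΛ + α * Real.log κ + 2 * D) / Real.log 2 + α) * Real.log K := by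
    rw [hA, add_mul, div_mul_eq_mul_div]
    gcongr
    rw [le_div_iff₀ hl2]
    gcongr
  have hlogK0 : 0 ≤ Real.log K := hl2.le.trans hlogK
  have hA0 : 0 ≤ A := by positivity
  have hscale : (2 : ℝ) ^ k ≤ Lsc L K κ k / (K * L) := by
    rw [le_div_iff₀ (by positivity)]
    refine le_trans ?_ (le_Lsc hL hK hκ k)
    have : 0 ≤ (L * K) * 2 ^ k := by positivity
    nlinarith
  have hDk : 0 ≤ D * ((k : ℝ) + 2) := by positivity
  calc A * 2 ^ k - D * (k + 2) ≤ A * 2 ^ k := by linarith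
    _ ≤ ((CΛ + α * Real.log κ + 2 * D) / Real.log 2 + α) * Real.log K *
        (Lsc L K κ k / (K * L)) := mul_le_mul hB hscale (by positivity) (hA0.trans hB)
    _ = _ := by ring

end LeafFamilies

/-- The Green function summed over a ball of radius `R`. -/
lemma Standing.sum_green_ball_le {lam dd : V → V → ℝ} {P : V → Measure (ℕ → V)}
    {α ν c₃ C₃ : ℝ} (h : Standing lam dd P α ν c₃ C₃) :
    ∃ C : ℝ, 0 < C ∧ ∀ R : ℝ, 1 ≤ R → ∀ z w : V, dd z w ≤ R → ∀ S : Finset V,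
      (∀ s ∈ S, dd z s ≤ R) → ∑ s ∈ S, green lam P w s ≤ C * R ^ (α - ν) := by
  obtain ⟨c, Cv, hc, hCv, hball⟩ := h.ball_card
  obtain ⟨Cg, hCg, hg, hg'⟩ := h.green_le
  have hν := h.nu_pos
  have hαν : 0 < α - ν := by linarith [h.nu_le]
  set q := (2 : ℝ) ^ (α - ν) with hq
  have hq1 : 1 < q := Real.one_lt_rpow (by norm_num) hαν
  have hq0 : 0 < q / (q - 1) := div_pos (by linarith) (by linarith)
  refine ⟨Cg * Cv + Cg * Cv * 2 ^ α * (q / (q - 1)), by positivity,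
    fun R hR z w hzw S hS => ?_⟩
  obtain ⟨n, hn, hn'⟩ := exists_nat_pow_near hR (by norm_num : (1 : ℝ) < 2)
  have hR0 : 0 < R := by linarith
  have hcard : ∀ (x : V) (r : ℝ), 1 ≤ r → ∀ T : Finset V, (∀ s ∈ T, dd x s ≤ r) →
      (T.card : ℝ) ≤ Cv * r ^ α := fun x r hr T hT => by
    obtain ⟨hf, -, hle⟩ := hball x r hr
    refine le_trans ?_ hle
    rw [← ncard_coe_finset]
    exact_mod_cast ncard_le_ncard (fun s hs => hT s hs) hf
  have key := sum_le_of_card_sublevel_le (dd w) (green lam P w) (M := Cg)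
    (r := fun j => 2 ^ j) (a := fun j => Cg * ((2 : ℝ) ^ j) ^ (-ν))
    (N := fun j => Cv * ((2 : ℝ) ^ j) ^ α) hCg.le (fun j => by positivity) (n + 1) S
    (fun s _ => hg w s)
    (fun j _ s _ hs => by
      have h2 : (0 : ℝ) < 2 ^ j := by positivity
      have hne : w ≠ s := fun e => by
        rw [e, h.dd_self] at hs
        linarith
      refine (hg' w s hne).trans (mul_le_mul_of_nonneg_left ?_ hCg.le)
      exact Real.rpow_le_rpow_of_nonpos h2 hs.le (by linarith))
    (fun j _ => hcard w _ (one_le_pow₀ (by norm_num)) _ fun s hs => (Finset.mem_filter.1 hs).2)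
    ((hcard z R hR S hS).trans (by gcongr; linarith [h.nu_le]))
  refine key.trans ?_
  have hterm : ∀ j : ℕ, Cg * ((2 : ℝ) ^ j) ^ (-ν) * (Cv * ((2 : ℝ) ^ (j + 1)) ^ α) =
      Cg * Cv * 2 ^ α * q ^ j := fun j => by
    rw [hq, pow_succ, Real.mul_rpow (by positivity) (by norm_num),
      ← Real.rpow_natCast_mul (by norm_num), ← Real.rpow_natCast_mul (by norm_num),
      ← Real.rpow_mul_natCast (by norm_num), mul_comm (α - ν), mul_sub, sub_eq_add_neg,
      Real.rpow_add (by norm_num), ← mul_neg]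
    ring
  simp only [hterm, ← Finset.mul_sum, pow_zero, Real.one_rpow, mul_one]
  have hgeo : ∑ j ∈ Finset.range (n + 1), q ^ j ≤ q / (q - 1) * R ^ (α - ν) := by
    refine (geom_sum_le_of_one_lt hq1 (n + 1)).trans ?_
    have : q ^ n ≤ R ^ (α - ν) := by
      rw [hq, ← Real.rpow_mul_natCast (by norm_num), mul_comm, Real.rpow_natCast_mul (by norm_num)]
      exact Real.rpow_le_rpow (by positivity) hn hαν.le
    rw [pow_succ, mul_div_assoc, mul_comm]
    gcongr
  have h1 : 1 ≤ R ^ (α - ν) := Real.one_le_rpow hR hαν.le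
  have h2 := mul_le_mul_of_nonneg_left hgeo (by positivity : 0 ≤ Cg * Cv * 2 ^ α)
  nlinarith [mul_le_mul_of_nonneg_left h1 (by positivity : 0 ≤ Cg * Cv)]

/-- Packing bound: well-separated points in a ball of comparable radius are bounded in number. -/
lemma Standing.packing {lam dd : V → V → ℝ} {P : V → Measure (ℕ → V)}
    {α ν c₃ C₃ : ℝ} (h : Standing lam dd P α ν c₃ C₃) :
    ∃ C : ℝ, 0 < C ∧ ∀ R : ℝ, 1 ≤ R → ∀ (ι : Type) (F : Finset ι) (f : ι → V) (x : V),
      (∀ i ∈ F, ∀ j ∈ F, i ≠ j → 2 * R < dd (f i) (f j)) → (∀ i ∈ F, dd x (f i) ≤ 11 * R) →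
      (F.card : ℝ) ≤ C := by
  obtain ⟨c, Cv, hc, hCv, hball⟩ := h.ball_card
  refine ⟨Cv * 12 ^ α / c, by positivity, fun R hR ι F f x hsep hx => ?_⟩
  have hR0 : 0 < R := by linarith
  let B : ι → Finset V := fun i => (hball (f i) R hR).1.toFinset
  have hmem : ∀ i v, v ∈ B i ↔ dd (f i) v ≤ R := fun i v => by simp [B, vball]
  have hdisj : (F : Set ι).PairwiseDisjoint B := fun i hi j hj hij => by
    refine Finset.disjoint_left.2 fun v hv hv' => ?_
    rw [hmem] at hv hv'
    have := hsep i hi j hj hij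
    have := h.dd_triangle (f i) v (f j)
    rw [h.dd_symm v] at this
    linarith
  have hlow : (F.card : ℝ) * (c * R ^ α) ≤ (F.biUnion B).card := by
    rw [Finset.card_biUnion hdisj, Nat.cast_sum, ← nsmul_eq_mul]
    refine Finset.card_nsmul_le_sum _ _ _ fun i _ => ?_
    have := (hball (f i) R hR).2.1
    rwa [ncard_eq_toFinset_card _ (hball (f i) R hR).1] at this
  have hup : ((F.biUnion B).card : ℝ) ≤ Cv * (12 * R) ^ α := by
    obtain ⟨hf, -, hle⟩ := hball x (12 * R) (by linarith)
    refine le_trans ?_ hle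
    rw [← ncard_coe_finset]
    refine Nat.cast_le.2 (ncard_le_ncard (fun v hv => ?_) hf)
    obtain ⟨i, hi, hv⟩ := Finset.mem_biUnion.1 (Finset.mem_coe.1 hv)
    rw [hmem] at hv
    have := h.dd_triangle x (f i) v
    have := hx i hi
    change dd x v ≤ 12 * R
    linarith
  rw [Real.mul_rpow (by norm_num) hR0.le] at hup
  have hRα : 0 < R ^ α := by positivity
  rw [le_div_iff₀ hc]
  refine le_of_mul_le_mul_right ?_ hRα
  linarith

lemma ProperEmbedding.leaf_sep {lam dd : V → V → ℝ} {P : V → Measure (ℕ → V)}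
    {α ν c₃ C₃ : ℝ} (h : Standing lam dd P α ν c₃ C₃) {Lam : ℝ → Set V} {L K κ : ℝ}
    (hL : 1 ≤ L) (hK : 2 ≤ K) (hκ : 9 ≤ κ) {k : ℕ} {x : V} {τ : List Bool → V}
    (hτ : ProperEmbedding lam dd Lam L K κ k x τ) {y : {σ : List Bool // σ.length = k} → V}
    (hy : ∀ σ, dd (τ σ.1) (y σ) ≤ lsc L K κ 0) {σ σ' : {σ : List Bool // σ.length = k}}
    (hne : σ ≠ σ') : 9 * Lsc L K κ 0 ≤ dd (y σ) (y σ') := by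
  have h0 : lsc L K κ 0 = Lsc L K κ 0 := by simp [lsc]
  have hpos := Lsc_pos hL hK hκ 0
  have hs := hτ.sep k le_rfl σ.1 σ'.1 σ.2 σ'.2 fun e => hne (Subtype.ext e)
  rw [Nat.sub_self, h0] at hs
  have h1 := hy σ
  have h2 := hy σ'
  rw [h0] at h1 h2
  have h3 := h.dd_triangle (τ σ.1) (y σ) (τ σ'.1)
  have h4 := h.dd_triangle (y σ) (y σ') (τ σ'.1)
  rw [h.dd_symm (y σ') (τ σ'.1)] at h4
  nlinarith

/-- At most a constant times `2 ^ j` leaves lie within distance `L_j` of a given leaf. -/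
lemma Standing.leaf_count_le {lam dd : V → V → ℝ} {P : V → Measure (ℕ → V)}
    {α ν c₃ C₃ : ℝ} (h : Standing lam dd P α ν c₃ C₃) {κ : ℝ} (hκ : 9 ≤ κ) :
    ∃ C : ℝ, 0 < C ∧ ∀ L K : ℝ, 1 ≤ L → 2 ≤ K → ∀ (Lam : ℝ → Set V) (k : ℕ) (x : V)
      (τ : List Bool → V) (_ : ProperEmbedding lam dd Lam L K κ k x τ)
      (y : {σ : List Bool // σ.length = k} → V) (_ : ∀ σ, dd (τ σ.1) (y σ) ≤ lsc L K κ 0)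
      (σ₀ : {σ : List Bool // σ.length = k}) (j : ℕ) (_ : j ≤ k)
      (F : Finset {σ : List Bool // σ.length = k}),
      (∀ σ ∈ F, dd (y σ₀) (y σ) ≤ Lsc L K κ j) → (F.card : ℝ) ≤ C * 2 ^ j := by
  obtain ⟨C, hC, hpack⟩ := h.packing
  refine ⟨C, hC, fun L K hL hK Lam k x τ hτ y hy σ₀ j hj F hF => ?_⟩
  have hnj : k - (k - j) = j := by omega
  have hlen : ∀ σ : {σ : List Bool // σ.length = k}, (σ.1.take (k - j)).length = k - j :=
    fun σ => by simp [σ.2]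
  have hlen' : ∀ σ : {σ : List Bool // σ.length = k}, (σ.1.drop (k - j)).length = j :=
    fun σ => by simp [σ.2, hnj]
  have hLj := Lsc_pos hL hK hκ j
  have hL0j := Lsc_mono hL hK hκ (Nat.zero_le j)
  have h0 : lsc L K κ 0 = Lsc L K κ 0 := by simp [lsc]
  have hanc : ∀ σ : {σ : List Bool // σ.length = k},
      dd (τ (σ.1.take (k - j))) (y σ) ≤ 5 * Lsc L K κ j := fun σ => by
    obtain ⟨v, hv, hv'⟩ := hτ.near (k - j) (Nat.sub_le _ _) _ (σ.1.drop (k - j)) (hlen σ)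
      (by rw [hlen' σ, hnj])
    rw [List.take_append_drop] at hv'
    rw [hnj] at hv
    change dd _ _ ≤ _ at hv hv'
    have h1 := h.dd_triangle (τ (σ.1.take (k - j))) v (y σ)
    have h2 := h.dd_triangle v (τ σ.1) (y σ)
    rw [h.dd_symm v (τ σ.1)] at h2
    have := hy σ
    linarith
  set I := F.image fun σ => σ.1.take (k - j) with hI
  have hIcard : (I.card : ℝ) ≤ C := by
    refine hpack (Lsc L K κ j) ?_ _ I τ (τ (σ₀.1.take (k - j))) ?_ ?_
    · have := one_le_lsc hL hK hκ 0
      linarith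
    · intro a ha b hb hab
      obtain ⟨σ, -, rfl⟩ := Finset.mem_image.1 ha
      obtain ⟨σ', -, rfl⟩ := Finset.mem_image.1 hb
      have := hτ.sep (k - j) (Nat.sub_le _ _) _ _ (hlen σ) (hlen σ') hab
      rw [hnj] at this
      have hl := lsc_pos hL hK hκ j
      nlinarith
    · intro a ha
      obtain ⟨σ, hσ, rfl⟩ := Finset.mem_image.1 ha
      have h1 := h.dd_triangle (τ (σ₀.1.take (k - j))) (y σ₀) (τ (σ.1.take (k - j)))
      have h2 := h.dd_triangle (y σ₀) (y σ) (τ (σ.1.take (k - j)))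
      rw [h.dd_symm (y σ)] at h2
      have := hanc σ
      have := hanc σ₀
      have := hF σ hσ
      linarith
  have hfib : F.card ≤ 2 ^ j * I.card := by
    refine Finset.card_le_mul_card_image F (2 ^ j) fun a _ => ?_
    have hcard : (Finset.univ : Finset (List.Vector Bool j)).card = 2 ^ j := by
      rw [Finset.card_univ, card_vector, Fintype.card_bool]
    rw [← hcard]
    refine Finset.card_le_card_of_injOn (fun σ => (⟨σ.1.drop (k - j), hlen' σ⟩ : List.Vector Bool j))
      (fun _ _ => Finset.mem_coe.2 (Finset.mem_univ _)) ?_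
    intro σ hσ σ' hσ' heq
    have h1 := (Finset.mem_filter.1 (Finset.mem_coe.1 hσ)).2
    have h2 := (Finset.mem_filter.1 (Finset.mem_coe.1 hσ')).2
    have h3 := congrArg Subtype.val heq
    simp only at h1 h2 h3
    refine Subtype.ext ?_
    rw [← List.take_append_drop (k - j) σ.1, ← List.take_append_drop (k - j) σ'.1, h1, h2, h3]
  calc (F.card : ℝ) ≤ 2 ^ j * I.card := by exact_mod_cast hfib
    _ ≤ 2 ^ j * C := by gcongr
    _ = _ := mul_comm _ _

/-- The energy of the leaves seen from one of them, without the diagonal term. -/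
lemma Standing.sum_leaf_le {lam dd : V → V → ℝ} {P : V → Measure (ℕ → V)}
    {α ν c₃ C₃ : ℝ} (h : Standing lam dd P α ν c₃ C₃) {κ : ℝ} (hκ : 9 ≤ κ) :
    ∃ C : ℝ, 0 < C ∧ ∀ L K : ℝ, 1 ≤ L → 2 ≤ K → ∀ (Lam : ℝ → Set V) (k : ℕ) (x : V)
      (τ : List Bool → V) (_ : ProperEmbedding lam dd Lam L K κ k x τ)
      (y : {σ : List Bool // σ.length = k} → V) (_ : ∀ σ, dd (τ σ.1) (y σ) ≤ lsc L K κ 0)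
      (S : Finset V) (_ : (S : Set V) ⊆ range y), ∀ z ∈ S,
      ∑ z' ∈ S.erase z, dd z z' ^ (-ν) ≤
        C * (L ^ (-ν) * K ^ (-ν) * ∑ j ∈ Finset.range (k + 1), ((2 : ℝ) ^ (1 - ν)) ^ j) := by
  obtain ⟨C, hC, hcount⟩ := h.leaf_count_le hκ
  have hν := h.nu_pos
  refine ⟨3 * C, by positivity, fun L K hL hK Lam k x τ hτ y hy S hS z hz => ?_⟩
  have hL0 : 0 < L := by linarith
  have hK0 : 0 < K := by linarith
  have hLK : 0 < L * K := by positivity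
  have hft : Fintype {σ : List Bool // σ.length = k} :=
    inferInstanceAs (Fintype (List.Vector Bool k))
  have hcu : Fintype.card {σ : List Bool // σ.length = k} = 2 ^ k := by
    have h1 := card_vector (α := Bool) k
    rw [Fintype.card_bool] at h1
    rw [← h1]
    exact Fintype.card_congr (Equiv.refl _)
  obtain ⟨σ₀, rfl⟩ := hS hz
  have hcard : ∀ j ≤ k, (((S.erase (y σ₀)).filter
      fun z' => dd (y σ₀) z' ≤ Lsc L K κ j).card : ℝ) ≤ C * 2 ^ j := fun j hj => by
    let F := Finset.univ.filter fun σ => dd (y σ₀) (y σ) ≤ Lsc L K κ j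
    refine le_trans ?_ (hcount L K hL hK Lam k x τ hτ y hy σ₀ j hj F
      fun σ hσ => (Finset.mem_filter.1 hσ).2)
    have hsub : ((S.erase (y σ₀)).filter fun z' => dd (y σ₀) z' ≤ Lsc L K κ j) ⊆ F.image y := by
      intro v hv
      obtain ⟨hv1, hv2⟩ := Finset.mem_filter.1 hv
      obtain ⟨σ, rfl⟩ := hS (Finset.mem_of_mem_erase hv1)
      exact Finset.mem_image.2 ⟨σ, Finset.mem_filter.2 ⟨Finset.mem_univ _, hv2⟩, rfl⟩
    exact_mod_cast (Finset.card_le_card hsub).trans Finset.card_image_le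
  have hC1 : 1 ≤ C := by
    have := hcount L K hL hK Lam k x τ hτ y hy σ₀ 0 (Nat.zero_le _) {σ₀} fun σ hσ => by
      rw [Finset.mem_singleton.1 hσ, h.dd_self]
      exact (Lsc_pos hL hK hκ 0).le
    simpa using this
  have hall : ((S.erase (y σ₀)).card : ℝ) ≤ C * 2 ^ (k + 1) := by
    have h1 : (S.erase (y σ₀)).card ≤ 2 ^ k := by
      refine (Finset.card_le_card (Finset.erase_subset _ _)).trans ?_
      have hsub : S ⊆ Finset.univ.image y := fun v hv => by
        obtain ⟨σ, rfl⟩ := hS hv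
        exact Finset.mem_image_of_mem _ (Finset.mem_univ _)
      refine (Finset.card_le_card hsub).trans (Finset.card_image_le.trans ?_)
      rw [Finset.card_univ, hcu]
    have h2 : ((S.erase (y σ₀)).card : ℝ) ≤ 2 ^ k := by exact_mod_cast h1
    refine h2.trans ?_
    rw [pow_succ]
    have : (0 : ℝ) < 2 ^ k := by positivity
    nlinarith
  have hLsc : ∀ j, L * K * 2 ^ j ≤ Lsc L K κ j := fun j => by
    refine le_trans ?_ (le_Lsc hL hK hκ j)
    have : 0 ≤ L * K * 2 ^ j := by positivity
    nlinarith
  have key := sum_le_of_card_sublevel_le (dd (y σ₀)) (fun z' => dd (y σ₀) z' ^ (-ν))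
    (M := (L * K) ^ (-ν)) (r := Lsc L K κ) (a := fun j => (L * K * 2 ^ j) ^ (-ν))
    (N := fun j => C * 2 ^ j) (by positivity) (fun j => by positivity) (k + 1) (S.erase (y σ₀))
    (fun z' hz' => by
      obtain ⟨σ, rfl⟩ := hS (Finset.mem_of_mem_erase hz')
      have hne : σ₀ ≠ σ := fun e => Finset.ne_of_mem_erase hz' (by rw [e])
      have h1 := hτ.leaf_sep h hL hK hκ hy hne
      have h2 := hLsc 0
      rw [pow_zero, mul_one] at h2
      exact Real.rpow_le_rpow_of_nonpos hLK (by linarith) (by linarith))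
    (fun j _ z' _ hz' => Real.rpow_le_rpow_of_nonpos (by positivity)
      ((hLsc j).trans hz'.le) (by linarith))
    (fun j hj => hcard j (by omega)) hall
  refine key.trans ?_
  have hterm : ∀ j : ℕ, (L * K * 2 ^ j) ^ (-ν) * (C * 2 ^ (j + 1)) =
      2 * C * (L * K) ^ (-ν) * ((2 : ℝ) ^ (1 - ν)) ^ j := fun j => by
    rw [Real.mul_rpow hLK.le (by positivity), sub_eq_add_neg, Real.rpow_add (by norm_num),
      Real.rpow_one, mul_pow, ← Real.rpow_mul_natCast (by norm_num),
      ← Real.rpow_natCast_mul (by norm_num), mul_comm (-ν)]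
    ring
  simp only [hterm, ← Finset.mul_sum]
  have hone : (1 : ℝ) ≤ ∑ j ∈ Finset.range (k + 1), ((2 : ℝ) ^ (1 - ν)) ^ j := by
    rw [Finset.sum_range_succ', pow_zero]
    have : 0 ≤ ∑ j ∈ Finset.range k, ((2 : ℝ) ^ (1 - ν)) ^ (j + 1) := by positivity
    linarith
  rw [← Real.mul_rpow hL0.le hK0.le, pow_zero, mul_one]
  have hpos : 0 ≤ (L * K) ^ (-ν) * C := by positivity
  nlinarith [mul_le_mul_of_nonneg_left hone hpos]

/-- Bound on the Green energy of the `8L`-neighbourhood of a large subfamily of leaves. -/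
lemma Standing.exists_leaf_energy_le {lam dd : V → V → ℝ} {P : V → Measure (ℕ → V)}
    {α ν c₃ C₃ : ℝ} (h : Standing lam dd P α ν c₃ C₃) {κ : ℝ} (hκ : 9 ≤ κ) :
    ∃ c : ℝ, 0 < c ∧ ∀ L K : ℝ, 1 ≤ L → 2 ≤ K → ∀ (Lam : ℝ → Set V) (k : ℕ) (x : V)
      (τ : List Bool → V) (_ : ProperEmbedding lam dd Lam L K κ k x τ)
      (y : {σ : List Bool // σ.length = k} → V) (_ : ∀ σ, dd (τ σ.1) (y σ) ≤ lsc L K κ 0)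
      (S : Finset V) (_ : (S : Set V) ⊆ range y) (_ : (2 : ℝ) ^ (k - 1) ≤ (S.card : ℝ)),
      (∑' w : (⋃ z ∈ (S : Set V), vball dd z (8 * L)),
          ∑' w' : (⋃ z ∈ (S : Set V), vball dd z (8 * L)), green lam P w w')
          / ((⋃ z ∈ (S : Set V), vball dd z (8 * L)).ncard : ℝ) ^ 2
        ≤ (c * Fnu ν (Lsc L K κ k) (L * K) * HbarNu ν (Lsc L K κ k / (L * K)) K)⁻¹ := by
  obtain ⟨c, Cv, hc, hCv, hball⟩ := h.ball_card
  obtain ⟨Cg, hCg, -, hg⟩ := h.green_le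
  obtain ⟨Cd, hCd, hdiag⟩ := h.sum_green_ball_le
  obtain ⟨Co, hCo, hoff⟩ := h.sum_leaf_le hκ
  obtain ⟨A, hA, hfinal⟩ := exists_energy_le hκ h.nu_pos
  have hν := h.nu_pos
  have hα : 0 < α := by linarith [h.nu_le]
  set C := Cd * 8 ^ (α - ν) + Cv * 8 ^ α * Cg * 2 ^ ν * Co with hCdef
  have hC : 0 < C := by positivity
  refine ⟨(2 * C / c * A)⁻¹, by positivity, fun L K hL hK Lam k x τ hτ y hy S hS hcard => ?_⟩
  have hL0 : 0 < L := by linarith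
  have hK0 : 0 < K := by linarith
  have h8 : 1 ≤ 8 * L := by linarith
  let B : V → Finset V := fun z => (hball z (8 * L) h8).1.toFinset
  have hmem : ∀ z v, v ∈ B z ↔ dd z v ≤ 8 * L := fun z v => by simp [B, vball]
  have hBcard : ∀ z, ((vball dd z (8 * L)).ncard : ℝ) = (B z).card := fun z => by
    rw [ncard_eq_toFinset_card _ (hball z (8 * L) h8).1]
  set U := S.biUnion B with hU
  have hUset : (⋃ z ∈ (S : Set V), vball dd z (8 * L)) = (U : Set V) := by
    ext v
    simp [hU, hmem, vball]
  rw [hUset, ncard_coe_finset]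
  have htsum : (∑' w : (U : Set V), ∑' w' : (U : Set V), green lam P w w') =
      ∑ w ∈ U, ∑ w' ∈ U, green lam P w w' := by
    simp only [fun w : V => Finset.tsum_subtype' U (green lam P w)]
    exact Finset.tsum_subtype' U fun w => ∑ w' ∈ U, green lam P w w'
  rw [htsum]
  -- Distinct leaves are far apart.
  have hsep : ∀ z ∈ S, ∀ z' ∈ S, z ≠ z' → 162 * L ≤ dd z z' := fun z hz z' hz' hne => by
    obtain ⟨σ, rfl⟩ := hS hz
    obtain ⟨σ', rfl⟩ := hS hz'
    have h1 := hτ.leaf_sep h hL hK hκ hy (fun e => hne (congrArg y e))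
    have h2 := le_Lsc hL hK hκ 0
    have h3 : 9 * (L * 2) ≤ κ * (L * K) := by gcongr
    linarith
  have hdisj : (S : Set V).PairwiseDisjoint B := fun z hz z' hz' hne => by
    refine Finset.disjoint_left.2 fun v hv hv' => ?_
    rw [hmem] at hv hv'
    have h1 := hsep z hz z' hz' hne
    have h2 := h.dd_triangle z v z'
    rw [h.dd_symm v z'] at h2
    linarith
  set T := ∑ j ∈ Finset.range (k + 1), ((2 : ℝ) ^ (1 - ν)) ^ j with hT
  have hT0 : 0 ≤ T := by positivity
  -- The potential of the neighbourhood at each of its points.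
  have hpot : ∀ w ∈ U, ∑ w' ∈ U, green lam P w w' ≤
      C * (L ^ α * L ^ (-ν) * (1 + K ^ (-ν) * T)) := fun w hw => by
    obtain ⟨z, hz, hwz⟩ := Finset.mem_biUnion.1 hw
    rw [hmem] at hwz
    rw [hU, Finset.sum_biUnion hdisj, ← Finset.add_sum_erase S _ hz]
    have h1 : ∑ w' ∈ B z, green lam P w w' ≤ Cd * (8 * L) ^ (α - ν) :=
      hdiag (8 * L) h8 z w hwz _ fun s hs => (hmem z s).1 hs
    have h2 : ∀ z' ∈ S.erase z, ∑ w' ∈ B z', green lam P w w' ≤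
        Cv * (8 * L) ^ α * (Cg * 2 ^ ν) * dd z z' ^ (-ν) := fun z' hz' => by
      have hd := hsep z hz z' (Finset.mem_of_mem_erase hz') (Finset.ne_of_mem_erase hz').symm
      have hle : ∀ w' ∈ B z', green lam P w w' ≤ Cg * 2 ^ ν * dd z z' ^ (-ν) := fun w' hw' => by
        rw [hmem] at hw'
        have h3 := h.dd_triangle z w z'
        have h4 := h.dd_triangle w w' z'
        rw [h.dd_symm w' z'] at h4
        have h5 : dd z z' / 2 ≤ dd w w' := by linarith
        have hne : w ≠ w' := fun e => by
          rw [e, h.dd_self] at h5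
          linarith
        refine (hg w w' hne).trans ?_
        rw [mul_assoc]
        refine mul_le_mul_of_nonneg_left ?_ hCg.le
        refine (Real.rpow_le_rpow_of_nonpos (by linarith) h5 (by linarith)).trans (le_of_eq ?_)
        rw [Real.div_rpow (by linarith) (by norm_num), Real.rpow_neg (by norm_num : (0 : ℝ) ≤ 2),
          div_inv_eq_mul, mul_comm]
      have h6 := Finset.sum_le_card_nsmul (B z') _ _ hle
      rw [nsmul_eq_mul] at h6
      refine h6.trans ?_
      rw [mul_assoc (Cv * (8 * L) ^ α)]
      refine mul_le_mul_of_nonneg_right ?_ ?_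
      · rw [← hBcard]
        exact (hball z' (8 * L) h8).2.2
      · have : 0 ≤ dd z z' := by linarith
        positivity
    have h3 := Finset.sum_le_sum h2
    rw [← Finset.mul_sum] at h3
    have h4 := mul_le_mul_of_nonneg_left (hoff L K hL hK Lam k x τ hτ y hy S hS z hz)
      (by positivity : 0 ≤ Cv * (8 * L) ^ α * (Cg * 2 ^ ν))
    refine (add_le_add h1 (h3.trans h4)).trans ?_
    rw [Real.mul_rpow (by norm_num) hL0.le, Real.mul_rpow (by norm_num) hL0.le,
      sub_eq_add_neg, Real.rpow_add hL0, ← sub_eq_add_neg]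
    set u := L ^ α * L ^ (-ν)
    have hu : 0 ≤ u := by positivity
    have hv : 0 ≤ K ^ (-ν) * T := by positivity
    have ha : 0 ≤ Cd * 8 ^ (α - ν) * (u * (K ^ (-ν) * T)) := by positivity
    have hb : 0 ≤ Cv * 8 ^ α * Cg * 2 ^ ν * Co * u := by positivity
    calc _ = Cd * 8 ^ (α - ν) * u +
          Cv * 8 ^ α * Cg * 2 ^ ν * Co * (u * (K ^ (-ν) * T)) := by
          simp only [u]
          ring
      _ ≤ _ := by
          rw [hCdef]
          linarith
  have hUlow : (2 : ℝ) ^ k / 2 * (c * L ^ α) ≤ U.card := by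
    have h1 : (S.card : ℝ) * (c * L ^ α) ≤ U.card := by
      rw [hU, Finset.card_biUnion hdisj, Nat.cast_sum, ← nsmul_eq_mul]
      refine Finset.card_nsmul_le_sum _ _ _ fun z _ => ?_
      rw [← hBcard]
      refine le_trans ?_ (hball z (8 * L) h8).2.1
      gcongr
      linarith
    refine le_trans (mul_le_mul_of_nonneg_right ?_ (by positivity)) h1
    refine le_trans ?_ hcard
    rw [div_le_iff₀ (by norm_num), ← pow_succ]
    exact pow_le_pow_right₀ (by norm_num) (by omega)
  have hUpos : (0 : ℝ) < U.card := lt_of_lt_of_le (by positivity) hUlow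
  have hsum := Finset.sum_le_card_nsmul U _ _ hpot
  rw [nsmul_eq_mul] at hsum
  calc (∑ w ∈ U, ∑ w' ∈ U, green lam P w w') / (U.card : ℝ) ^ 2
      ≤ (U.card * (C * (L ^ α * L ^ (-ν) * (1 + K ^ (-ν) * T)))) / (U.card : ℝ) ^ 2 := by gcongr
    _ = C * (L ^ α * L ^ (-ν) * (1 + K ^ (-ν) * T)) / U.card := by
        field_simp
    _ ≤ C * (L ^ α * L ^ (-ν) * (1 + K ^ (-ν) * T)) / ((2 : ℝ) ^ k / 2 * (c * L ^ α)) := by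
        gcongr
    _ = 2 * C / c * (L ^ (-ν) * ((2 : ℝ) ^ k)⁻¹ * (1 + K ^ (-ν) * T)) := by
        field_simp
    _ ≤ 2 * C / c * (A * (Fnu ν (Lsc L K κ k) (L * K) *
          HbarNu ν (Lsc L K κ k / (L * K)) K)⁻¹) :=
        mul_le_mul_of_nonneg_left (hfinal L K hL hK k) (by positivity)
    _ = _ := by
        rw [mul_assoc (2 * C / c * A)⁻¹, mul_inv (2 * C / c * A)⁻¹, inv_inv, mul_assoc (2 * C / c)]

/-- Lemma `lem:properembedding`: entropy bound on `𝒜̃_{x,k}` and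
capacity-type bound on the Green energy of subfamilies. -/
theorem statement17
    (V : Type) [MeasurableSpace V]
    (lam dd : V → V → ℝ) (P : V → Measure (ℕ → V)) (α ν c₃ C₃ : ℝ)
    (hSt : Standing lam dd P α ν c₃ C₃)
    (Lam : ℝ → Set V) (hLam : LamFamily dd α Lam) :
    ∀ κ : ℝ, 9 ≤ κ →
    ∃ c C : ℝ, 0 < c ∧ 0 < C ∧
      ∀ L K : ℝ, 1 ≤ L → 2 ≤ K → ∀ k : ℕ, 1 ≤ k → ∀ x : V,
        ((Atil lam dd Lam L K κ k x).Finite ∧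
          ((Atil lam dd Lam L K κ k x).ncard : ℝ)
            ≤ Real.exp (C * Lsc L K κ k * Real.log K / (K * L))) ∧
        ∀ y ∈ Atil lam dd Lam L K κ k x, ∀ 𝒞' : Set V,
          𝒞' ⊆ Set.range y → (2:ℝ) ^ (k - 1) ≤ (𝒞'.ncard : ℝ) →
          (∑' w : (⋃ z ∈ 𝒞', vball dd z (8 * L)),
              ∑' w' : (⋃ z ∈ 𝒞', vball dd z (8 * L)), green lam P w w')
              / ((⋃ z ∈ 𝒞', vball dd z (8 * L)).ncard : ℝ) ^ 2
            ≤ (c * Fnu ν (Lsc L K κ k) (L * K) *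
                HbarNu ν (Lsc L K κ k / (L * K)) K)⁻¹ := by
  intro κ hκ
  obtain ⟨C, hC, hentropy⟩ := hLam.leafFamily_card_le (by linarith [hSt.nu_pos, hSt.nu_le]) hκ
  obtain ⟨c, hc, henergy⟩ := hSt.exists_leaf_energy_le hκ
  refine ⟨c, C, hc, hC, fun L K hL hK k _ x => ⟨?_, ?_⟩⟩
  · obtain ⟨hfin, hcard⟩ := hentropy L K hL hK k x
    have hsub := Atil_subset_leafFamily lam dd Lam L K κ k x
    refine ⟨hfin.subset hsub, le_trans ?_ hcard⟩
    exact_mod_cast ncard_le_ncard hsub hfin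
  · rintro y ⟨-, τ, hτ, hy⟩ 𝒞' hsub hcard
    have hfin : (range y).Finite := by
      have : Finite {σ : List Bool // σ.length = k} :=
        inferInstanceAs (Finite (List.Vector Bool k))
      exact finite_range y
    obtain ⟨S, rfl⟩ := (hfin.subset hsub).exists_finset_coe
    rw [ncard_coe_finset] at hcard
    exact henergy L K hL hK Lam k x τ hτ y hy S hsub hcard

end Paper
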